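/- arXiv:1904.12345 — 2 statements merged into one kernel-verified Lean document; each statement's English description precedes it below -/
import Mathlib

section
/- Let g ∈ S₀(ℝ), let Λ ⊆ ℝ² be a lattice, and set 𝒢 = 𝒢(g, Λ). Let ε > 0 be such that for every lattice Γ ⊆ ℝ² with B_ε(Γ) = ℝ², the Gabor system (g, Γ) is a frame for L²(ℝ). If there exist linearly independent vectors v₁, v₂ ∈ B_ε(0) ∩ 𝔍(𝒢), then 𝒢 = L²(ℝ). -/
open MeasureTheory Complex Filter
open scoped ENNReal InnerProductSpace RealInnerProductSpace ComplexConjugate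

noncomputable section

/-- The Hilbert space `L²(ℝ)` of complex-valued square-integrable functions. -/
abbrev L2 : Type := Lp ℂ 2 (volume : Measure ℝ)

lemma memLp_translate (a : ℝ) (f : L2) :
    MemLp (fun x : ℝ => f (x - a)) 2 (volume : Measure ℝ) :=
  (Lp.memLp f).comp_measurePreserving (measurePreserving_sub_right volume a)

lemma memLp_modulate (b : ℝ) (f : L2) :
    MemLp (fun x : ℝ => Complex.exp (2 * Real.pi * Complex.I * (b * x)) * f x) 2
      (volume : Measure ℝ) := by
  refine MemLp.of_le (Lp.memLp f) ?_ ?_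
  · exact (Complex.continuous_exp.comp (by fun_prop)).aestronglyMeasurable.mul
      (Lp.aestronglyMeasurable f)
  · filter_upwards with x
    have : Complex.exp (2 * Real.pi * Complex.I * (b * x))
        = Complex.exp ((2 * Real.pi * (b * x) : ℝ) * Complex.I) := by
      push_cast; ring_nf
    rw [norm_mul, this, Complex.norm_exp_ofReal_mul_I, one_mul]

/-- Translation `T_a` on `L²(ℝ)`: `(T_a f)(x) = f (x - a)`. -/
def Tr (a : ℝ) (f : L2) : L2 := (memLp_translate a f).toLp _

/-- Modulation `M_b` on `L²(ℝ)`: `(M_b f)(x) = e^{2πibx} f x`. -/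
def Mo (b : ℝ) (f : L2) : L2 := (memLp_modulate b f).toLp _

/-- Time-frequency shift `π(a,b) = T_a M_b`. -/
def tf (z : ℝ × ℝ) (f : L2) : L2 := Tr z.1 (Mo z.2 f)

/-- The closed linear span `𝒢(g,Λ)` of the Gabor system `(g,Λ)`. -/
def gaborSpan (g : L2) (Λ : Set (ℝ × ℝ)) : Set L2 :=
  closure (Submodule.span ℂ ((fun z => tf z g) '' Λ) : Set L2)

/-- `𝔍(𝒢)`: the set of time-frequency shifts leaving `𝒢` invariant. -/
def stab (G : Set L2) : Set (ℝ × ℝ) := {z | ∀ f ∈ G, tf z f ∈ G}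

/-- `Λ` is a lattice in `ℝ²` if `Λ = Aℤ²` for an invertible `2×2` matrix `A`. -/
def IsLattice (Λ : Set (ℝ × ℝ)) : Prop :=
  ∃ A : Matrix (Fin 2) (Fin 2) ℝ, IsUnit A.det ∧
    Λ = {p : ℝ × ℝ | ∃ k l : ℤ,
      p = (A 0 0 * k + A 0 1 * l, A 1 0 * k + A 1 1 * l)}

lemma memLp_gaussian : MemLp (fun x : ℝ => (Real.exp (-Real.pi * x ^ 2) : ℂ)) 2
    (volume : Measure ℝ) := by
  rw [memLp_two_iff_integrable_sq_norm]
  · have h : Integrable (fun x : ℝ => Real.exp (-(2 * Real.pi) * x ^ 2)) volume :=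
      integrable_exp_neg_mul_sq (by positivity)
    refine h.congr (Eventually.of_forall fun x => ?_)
    simp only [Complex.norm_real, Real.norm_eq_abs, Real.abs_exp, sq, ← Real.exp_add]
    ring_nf
  · exact (Complex.continuous_ofReal.comp (by fun_prop)).aestronglyMeasurable

/-- The Gaussian `φ(x) = e^{-πx²}` as an element of `L²(ℝ)`. -/
def gaussL2 : L2 := memLp_gaussian.toLp _

/-- The Feichtinger algebra condition: `f ∈ S₀(ℝ)` iff `(a,b) ↦ ⟨f, π(a,b)φ⟩ ∈ L¹(ℝ²)`. -/
def InS0 (f : L2) : Prop :=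
  Integrable (fun z : ℝ × ℝ => ⟪tf z gaussL2, f⟫_ℂ) (volume : Measure (ℝ × ℝ))

/-- `(g,Λ)` is a frame for its closed linear span. -/
def IsFrameSeq (g : L2) (Λ : Set (ℝ × ℝ)) : Prop :=
  ∃ A B : ℝ, 0 < A ∧ 0 < B ∧ ∀ f ∈ gaborSpan g Λ,
    A * ‖f‖ ^ 2 ≤ ∑' lam : Λ, ‖⟪tf (lam : ℝ × ℝ) g, f⟫_ℂ‖ ^ 2 ∧
    ∑' lam : Λ, ‖⟪tf (lam : ℝ × ℝ) g, f⟫_ℂ‖ ^ 2 ≤ B * ‖f‖ ^ 2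

/-- `(g,Λ)` is a frame for all of `L²(ℝ)`. -/
def IsFrameL2 (g : L2) (Λ : Set (ℝ × ℝ)) : Prop :=
  ∃ A B : ℝ, 0 < A ∧ 0 < B ∧ ∀ f : L2,
    A * ‖f‖ ^ 2 ≤ ∑' lam : Λ, ‖⟪tf (lam : ℝ × ℝ) g, f⟫_ℂ‖ ^ 2 ∧
    ∑' lam : Λ, ‖⟪tf (lam : ℝ × ℝ) g, f⟫_ℂ‖ ^ 2 ≤ B * ‖f‖ ^ 2

/-- Euclidean ball of radius `ε` around `a ∈ ℝ²`. -/
def eball (ε : ℝ) (a : ℝ × ℝ) : Set (ℝ × ℝ) :=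
  {x : ℝ × ℝ | Real.sqrt ((x.1 - a.1) ^ 2 + (x.2 - a.2) ^ 2) < ε}

/-- `B_ε(Δ) = ⋃_{a ∈ Δ} B_ε(a)`. -/
def eballSet (ε : ℝ) (Δ : Set (ℝ × ℝ)) : Set (ℝ × ℝ) := ⋃ a ∈ Δ, eball ε a

/-- The separable lattice `αℤ × βℤ`. -/
def sepLattice (α β : ℝ) : Set (ℝ × ℝ) :=
  {p : ℝ × ℝ | ∃ k l : ℤ, p = (α * k, β * l)}

lemma Tr_eq_compMeasurePreserving (a : ℝ) (f : L2) :
    Tr a f = Lp.compMeasurePreserving (fun x : ℝ => x - a)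
      (measurePreserving_sub_right volume a) f := by
  apply Lp.ext
  filter_upwards [(memLp_translate a f).coeFn_toLp,
    Lp.coeFn_compMeasurePreserving f (measurePreserving_sub_right volume a)] with x h₁ h₂
  rw [Tr, h₁, h₂, Function.comp_apply]

lemma coeFn_Mo (b : ℝ) (f : L2) :
    Mo b f =ᵐ[volume] fun x : ℝ => Complex.exp (2 * Real.pi * Complex.I * (b * x)) * f x :=
  (memLp_modulate b f).coeFn_toLp

lemma coeFn_tf (z : ℝ × ℝ) (f : L2) :
    tf z f =ᵐ[volume] fun x : ℝ =>
      Complex.exp (2 * Real.pi * Complex.I * (z.2 * ((x - z.1 : ℝ) : ℂ))) * f (x - z.1) := by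
  have hq := (measurePreserving_sub_right volume z.1).quasiMeasurePreserving
  filter_upwards [(memLp_translate z.1 (Mo z.2 f)).coeFn_toLp,
    hq.ae (coeFn_Mo z.2 f)] with x h₁ h₂
  rw [tf, Tr, h₁, h₂]

lemma norm_exp_two_pi_I_mul (b x : ℝ) :
    ‖Complex.exp (2 * Real.pi * Complex.I * (b * x))‖ = 1 := by
  have : (2 * Real.pi * Complex.I * (b * x) : ℂ) = ((2 * Real.pi * (b * x) : ℝ) : ℂ) * Complex.I := by
    push_cast; ring
  rw [this, Complex.norm_exp_ofReal_mul_I]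

lemma norm_Mo (b : ℝ) (f : L2) : ‖Mo b f‖ = ‖f‖ := by
  apply le_antisymm
  · refine Lp.norm_le_norm_of_ae_le ?_
    filter_upwards [coeFn_Mo b f] with x hx
    rw [hx, norm_mul, norm_exp_two_pi_I_mul, one_mul]
  · refine Lp.norm_le_norm_of_ae_le ?_
    filter_upwards [coeFn_Mo b f] with x hx
    rw [hx, norm_mul, norm_exp_two_pi_I_mul, one_mul]

lemma norm_tf (z : ℝ × ℝ) (f : L2) : ‖tf z f‖ = ‖f‖ := by
  rw [tf, Tr_eq_compMeasurePreserving, Lp.norm_compMeasurePreserving, norm_Mo]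

lemma tf_add_apply (z : ℝ × ℝ) (f h : L2) : tf z (f + h) = tf z f + tf z h := by
  have hq := (measurePreserving_sub_right volume z.1).quasiMeasurePreserving
  apply Lp.ext
  filter_upwards [coeFn_tf z (f + h), coeFn_tf z f, coeFn_tf z h,
    Lp.coeFn_add (tf z f) (tf z h), hq.ae (Lp.coeFn_add f h)] with x h₁ h₂ h₃ h₄ h₅
  rw [h₁, h₄, h₅, Pi.add_apply, Pi.add_apply, h₂, h₃, mul_add]

lemma tf_smul_apply (z : ℝ × ℝ) (c : ℂ) (f : L2) : tf z (c • f) = c • tf z f := by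
  have hq := (measurePreserving_sub_right volume z.1).quasiMeasurePreserving
  apply Lp.ext
  filter_upwards [coeFn_tf z (c • f), coeFn_tf z f,
    Lp.coeFn_smul c (tf z f), hq.ae (Lp.coeFn_smul c f)] with x h₁ h₂ h₃ h₄
  rw [h₁, h₃, h₄, Pi.smul_apply, Pi.smul_apply, h₂, smul_eq_mul, smul_eq_mul]
  ring

/-- The time-frequency shift `π(z)` as a linear isometry of `L²(ℝ)`. -/
def tfIsometry (z : ℝ × ℝ) : L2 →ₗᵢ[ℂ] L2 where
  toFun := tf z
  map_add' := tf_add_apply z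
  map_smul' := tf_smul_apply z
  norm_map' := norm_tf z

lemma tf_zero_left (f : L2) : tf 0 f = f := by
  apply Lp.ext
  filter_upwards [coeFn_tf 0 f] with x h
  simp [h]

/-- Time-frequency shifts compose up to a unimodular phase. -/
lemma tf_tf (z w : ℝ × ℝ) (f : L2) :
    tf z (tf w f) =
      Complex.exp (2 * Real.pi * Complex.I * (z.2 * w.1)) • tf (z + w) f := by
  have hq := (measurePreserving_sub_right volume z.1).quasiMeasurePreserving
  apply Lp.ext
  filter_upwards [coeFn_tf z (tf w f), hq.ae (coeFn_tf w f), coeFn_tf (z + w) f,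
    Lp.coeFn_smul (Complex.exp (2 * Real.pi * Complex.I * (z.2 * w.1))) (tf (z + w) f)]
    with x h₁ h₂ h₃ h₄
  rw [h₁, h₂, h₄, Pi.smul_apply, h₃, smul_eq_mul, ← mul_assoc (Complex.exp _),
    ← mul_assoc (Complex.exp _), ← Complex.exp_add, ← Complex.exp_add, Prod.fst_add,
    Prod.snd_add, sub_sub]
  congr 2
  push_cast
  ring

lemma continuous_Mo (f : L2) : Continuous fun b : ℝ => Mo b f := by
  have hweak : ∀ h : L2, Continuous fun b : ℝ => ⟪h, Mo b f⟫_ℂ := by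
    intro h
    have heq : (fun b : ℝ => ⟪h, Mo b f⟫_ℂ) = fun b : ℝ =>
        ∫ x : ℝ, Complex.exp (2 * Real.pi * Complex.I * (b * x)) * ⟪h x, f x⟫_ℂ := by
      funext b
      rw [L2.inner_def]
      refine integral_congr_ae ?_
      filter_upwards [coeFn_Mo b f] with x hx
      rw [hx, ← smul_eq_mul, inner_smul_right]
    rw [heq]
    have hint := L2.integrable_inner (𝕜 := ℂ) h f
    refine continuous_of_dominated (bound := fun x => ‖⟪h x, f x⟫_ℂ‖) ?_ ?_ hint.norm ?_
    · intro b
      exact (Complex.continuous_exp.comp (by fun_prop)).aestronglyMeasurable.mul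
        hint.aestronglyMeasurable
    · intro b
      filter_upwards with x
      rw [norm_mul, norm_exp_two_pi_I_mul, one_mul]
    · filter_upwards with x
      fun_prop
  rw [continuous_iff_continuousAt]
  intro b₀
  rw [ContinuousAt, tendsto_iff_norm_sub_tendsto_zero]
  have hsq : ∀ b, ‖Mo b f - Mo b₀ f‖ =
      Real.sqrt (2 * ‖f‖ ^ 2 - 2 * (⟪Mo b₀ f, Mo b f⟫_ℂ).re) := by
    intro b
    rw [← Real.sqrt_sq (norm_nonneg (Mo b f - Mo b₀ f)), norm_sub_sq (𝕜 := ℂ), norm_Mo, norm_Mo,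
      inner_re_symm]
    congr 1
    simp only [RCLike.re_to_complex]
    ring
  have hc : Continuous fun b => ‖Mo b f - Mo b₀ f‖ := by
    simp_rw [hsq]
    have := hweak (Mo b₀ f)
    fun_prop
  simpa using hc.tendsto b₀

lemma continuous_tf (f : L2) : Continuous fun z : ℝ × ℝ => tf z f := by
  let shift : C(ℝ × ℝ, C(ℝ, ℝ)) :=
    ContinuousMap.curry ⟨fun p : (ℝ × ℝ) × ℝ => p.2 - p.1.1, by fun_prop⟩
  have h := Continuous.compMeasurePreservingLp (p := 2) (μ := (volume : Measure ℝ))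
    ((continuous_Mo f).comp continuous_snd) shift.continuous
    (fun z : ℝ × ℝ => measurePreserving_sub_right volume z.1) (by simp)
  simp only [tf, Tr_eq_compMeasurePreserving]
  exact h

/-- The time-frequency shifts leaving a subspace invariant form an additive monoid. -/
def stabAddSubmonoid (V : Submodule ℂ L2) : AddSubmonoid (ℝ × ℝ) where
  carrier := stab V
  zero_mem' f hf := by rwa [tf_zero_left]
  add_mem' {z w} hz hw f hf := by
    have h := V.smul_mem (Complex.exp (2 * Real.pi * Complex.I * (z.2 * w.1)))⁻¹
      (hz _ (hw f hf))
    rwa [tf_tf, inv_smul_smul₀ (Complex.exp_ne_zero _)] at h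

lemma isClosed_stab {G : Set L2} (hG : IsClosed G) : IsClosed (stab G) := by
  simp only [stab, Set.ofPred_forall]
  exact isClosed_iInter fun f => isClosed_iInter fun _ => hG.preimage (continuous_tf f)

lemma gaborSpan_eq_topologicalClosure (g : L2) (Λ : Set (ℝ × ℝ)) :
    gaborSpan g Λ =
      ((Submodule.span ℂ ((fun z => tf z g) '' Λ)).topologicalClosure : Set L2) := rfl

lemma IsLattice.add_mem {Λ : Set (ℝ × ℝ)} (hΛ : IsLattice Λ) {z w : ℝ × ℝ} (hz : z ∈ Λ)
    (hw : w ∈ Λ) : z + w ∈ Λ := by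
  obtain ⟨A, -, rfl⟩ := hΛ
  obtain ⟨k, l, rfl⟩ := hz
  obtain ⟨m, n, rfl⟩ := hw
  exact ⟨k + m, l + n, by ext <;> push_cast <;> simp <;> ring⟩

lemma IsLattice.zero_mem {Λ : Set (ℝ × ℝ)} (hΛ : IsLattice Λ) : (0 : ℝ × ℝ) ∈ Λ := by
  obtain ⟨A, -, rfl⟩ := hΛ
  exact ⟨0, 0, by ext <;> simp⟩

lemma IsLattice.subset_stab_gaborSpan {Λ : Set (ℝ × ℝ)} (hΛ : IsLattice Λ) (g : L2) :
    Λ ⊆ stab (gaborSpan g Λ) := by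
  intro z hz f hf
  refine map_mem_closure (tfIsometry z).continuous hf fun h hh => ?_
  have hle : Submodule.span ℂ ((fun w => tf w g) '' Λ) ≤
      (Submodule.span ℂ ((fun w => tf w g) '' Λ)).comap (tfIsometry z).toLinearMap := by
    rw [Submodule.span_le]
    rintro _ ⟨w, hw, rfl⟩
    change tf z (tf w g) ∈ Submodule.span ℂ ((fun w => tf w g) '' Λ)
    rw [tf_tf]
    exact Submodule.smul_mem _ _ (Submodule.subset_span ⟨z + w, hΛ.add_mem hz hw, rfl⟩)
  exact hle hh

/-- A closed additive submonoid of the plane containing a lattice is closed under negation, since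
its image in the compact quotient by the lattice is a group. -/
lemma IsLattice.neg_mem_of_isClosed {Λ : Set (ℝ × ℝ)} (hΛ : IsLattice Λ)
    (S : AddSubmonoid (ℝ × ℝ)) (hS : IsClosed (S : Set (ℝ × ℝ))) (hΛS : Λ ⊆ S)
    {v : ℝ × ℝ} (hv : v ∈ S) : -v ∈ S := by
  obtain ⟨A, hA, rfl⟩ := hΛ
  rw [isUnit_iff_ne_zero, Matrix.det_fin_two] at hA
  set d := A 0 0 * A 1 1 - A 0 1 * A 1 0 with hd
  let L : ℝ × ℝ → ℝ × ℝ := fun p => (A 0 0 * p.1 + A 0 1 * p.2, A 1 0 * p.1 + A 1 1 * p.2)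
  have hL : Continuous L := by fun_prop
  obtain ⟨p, rfl⟩ : ∃ p, L p = v := by
    refine ⟨((A 1 1 * v.1 - A 0 1 * v.2) / d, (A 0 0 * v.2 - A 1 0 * v.1) / d), ?_⟩
    ext <;> simp only [L] <;> field_simp <;> rw [hd] <;> ring
  let x : ℕ → ℝ × ℝ := fun n => (Int.fract (n * p.1), Int.fract (n * p.2))
  obtain ⟨y, -, φ, hφ, hlim⟩ := (isCompact_Icc (a := (0 : ℝ)) (b := 1)).prod
    (isCompact_Icc (a := (0 : ℝ)) (b := 1)) |>.tendsto_subseq (x := x) fun n =>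
      ⟨⟨Int.fract_nonneg _, (Int.fract_lt_one _).le⟩, ⟨Int.fract_nonneg _, (Int.fract_lt_one _).le⟩⟩
  have hlim' : Tendsto (fun k => L (x (φ (k + 1)) - x (φ k)) - L p) atTop (nhds (-L p)) := by
    have h0 := (hlim.comp (tendsto_add_atTop_nat 1)).sub hlim
    rw [sub_self] at h0
    have h1 := ((hL.tendsto 0).comp h0).sub_const (L p)
    have hL0 : L 0 = 0 := by ext <;> simp [L]
    rwa [hL0, zero_sub] at h1
  refine hS.mem_of_tendsto hlim' (Eventually.of_forall fun k => ?_)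
  obtain ⟨m, hm⟩ := Nat.exists_eq_add_of_lt (hφ (Nat.lt_succ_self k))
  have hdecomp : L (x (φ (k + 1)) - x (φ k)) - L p = m • L p +
      (A 0 0 * ((⌊φ k * p.1⌋ - ⌊φ (k + 1) * p.1⌋ : ℤ) : ℝ) +
          A 0 1 * ((⌊φ k * p.2⌋ - ⌊φ (k + 1) * p.2⌋ : ℤ) : ℝ),
        A 1 0 * ((⌊φ k * p.1⌋ - ⌊φ (k + 1) * p.1⌋ : ℤ) : ℝ) +
          A 1 1 * ((⌊φ k * p.2⌋ - ⌊φ (k + 1) * p.2⌋ : ℤ) : ℝ)) := by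
    have hm' : (φ (k + 1) : ℝ) = φ k + m + 1 := by exact_mod_cast hm
    rw [← Nat.cast_smul_eq_nsmul ℝ]
    ext <;> simp only [L, x, Int.fract, Prod.fst_sub, Prod.snd_sub, Prod.fst_add, Prod.snd_add,
      Prod.smul_fst, Prod.smul_snd, smul_eq_mul] <;> push_cast <;> rw [hm'] <;> ring
  rw [hdecomp]
  exact S.add_mem (S.nsmul_mem hv m) (hΛS ⟨_, _, rfl⟩)

lemma AddSubmonoid.zsmul_mem_of_neg_mem {G : Type*} [AddGroup G] (S : AddSubmonoid G) {v : G}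
    (hv : v ∈ S) (hv' : -v ∈ S) (k : ℤ) : k • v ∈ S := by
  obtain ⟨n, rfl | rfl⟩ := k.eq_nat_or_neg
  · rw [natCast_zsmul]; exact S.nsmul_mem hv n
  · rw [neg_zsmul, natCast_zsmul, ← neg_nsmul]; exact S.nsmul_mem hv' n

/-- The lattice spanned by two vectors. -/
def latticeOf (v₁ v₂ : ℝ × ℝ) : Set (ℝ × ℝ) := {p | ∃ k l : ℤ, p = k • v₁ + l • v₂}

lemma isLattice_latticeOf {v₁ v₂ : ℝ × ℝ} (hd : v₁.1 * v₂.2 - v₂.1 * v₁.2 ≠ 0) :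
    IsLattice (latticeOf v₁ v₂) := by
  refine ⟨!![v₁.1, v₂.1; v₁.2, v₂.2], ?_, ?_⟩
  · rwa [isUnit_iff_ne_zero, Matrix.det_fin_two_of]
  · ext p
    simp [latticeOf, Prod.ext_iff, mul_comm]

lemma det_ne_zero_of_linearIndependent {v₁ v₂ : ℝ × ℝ} (hli : LinearIndependent ℝ ![v₁, v₂]) :
    v₁.1 * v₂.2 - v₂.1 * v₁.2 ≠ 0 := by
  intro hd
  rw [LinearIndependent.pair_iff] at hli
  obtain ⟨h₁, h₂⟩ := hli v₂.2 (-v₁.2) (by ext <;> simp <;> linarith)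
  obtain ⟨h₃, h₄⟩ := hli v₂.1 (-v₁.1) (by ext <;> simp <;> linarith)
  have hv : v₁ = 0 := by ext <;> simp <;> linarith
  have := hli 1 0 (by simp [hv])
  simp at this

/-- Balls of radius exceeding the lengths of the generators of a lattice cover the plane. -/
lemma eballSet_latticeOf {v₁ v₂ : ℝ × ℝ} {ε : ℝ} (hd : v₁.1 * v₂.2 - v₂.1 * v₁.2 ≠ 0)
    (h₁ : v₁ ∈ eball ε 0) (h₂ : v₂ ∈ eball ε 0) :
    eballSet ε (latticeOf v₁ v₂) = Set.univ := by
  refine Set.eq_univ_of_forall fun x => ?_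
  set d := v₁.1 * v₂.2 - v₂.1 * v₁.2 with hdef
  obtain ⟨s, hs⟩ : ∃ s, s = (x.1 * v₂.2 - v₂.1 * x.2) / d := ⟨_, rfl⟩
  obtain ⟨t, ht⟩ : ∃ t, t = (v₁.1 * x.2 - x.1 * v₁.2) / d := ⟨_, rfl⟩
  have hx₁ : x.1 = s * v₁.1 + t * v₂.1 := by rw [hs, ht]; field_simp; rw [hdef]; ring
  have hx₂ : x.2 = s * v₁.2 + t * v₂.2 := by rw [hs, ht]; field_simp; rw [hdef]; ring
  simp only [eball, Set.mem_ofPred_eq, Prod.fst_zero, Prod.snd_zero, sub_zero] at h₁ h₂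
  have hε : 0 < ε := (Real.sqrt_nonneg _).trans_lt h₁
  rw [Real.sqrt_lt' hε] at h₁ h₂
  simp only [eballSet, Set.mem_iUnion]
  refine ⟨round s • v₁ + round t • v₂, ⟨_, _, rfl⟩, ?_⟩
  simp only [eball, Set.mem_ofPred_eq]
  rw [Real.sqrt_lt' hε]
  have ha := abs_sub_round s
  have hb := abs_sub_round t
  have e₁ : x.1 - (round s • v₁ + round t • v₂).1 =
      (s - round s) * v₁.1 + (t - round t) * v₂.1 := by
    rw [hx₁]; simp; ring
  have e₂ : x.2 - (round s • v₁ + round t • v₂).2 =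
      (s - round s) * v₁.2 + (t - round t) * v₂.2 := by
    rw [hx₂]; simp; ring
  rw [e₁, e₂]
  generalize s - round s = a at ha
  generalize t - round t = b at hb
  have ha2 : a ^ 2 ≤ 1 / 4 := by rw [← sq_abs]; nlinarith [abs_nonneg a]
  have hb2 : b ^ 2 ≤ 1 / 4 := by rw [← sq_abs]; nlinarith [abs_nonneg b]
  have hA : a ^ 2 * (v₁.1 ^ 2 + v₁.2 ^ 2) ≤ 1 / 4 * (v₁.1 ^ 2 + v₁.2 ^ 2) := by gcongr
  have hB : b ^ 2 * (v₂.1 ^ 2 + v₂.2 ^ 2) ≤ 1 / 4 * (v₂.1 ^ 2 + v₂.2 ^ 2) := by gcongr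
  nlinarith [sq_nonneg (a * v₁.1 - b * v₂.1), sq_nonneg (a * v₁.2 - b * v₂.2)]

/-- A frame for `L²(ℝ)` is complete. -/
lemma IsFrameL2.gaborSpan_eq_univ {g : L2} {Γ : Set (ℝ × ℝ)} (h : IsFrameL2 g Γ) :
    gaborSpan g Γ = Set.univ := by
  obtain ⟨A, B, hA, -, hAB⟩ := h
  rw [gaborSpan_eq_topologicalClosure, (Submodule.topologicalClosure_eq_top_iff).2,
    Submodule.top_coe]
  rw [Submodule.eq_bot_iff]
  intro f hf
  have hzero : ∀ lam : Γ, ‖⟪tf (lam : ℝ × ℝ) g, f⟫_ℂ‖ ^ 2 = 0 := fun lam => by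
    rw [(Submodule.mem_orthogonal _ f).1 hf _ (Submodule.subset_span ⟨lam, lam.2, rfl⟩)]
    simp
  have hle := (hAB f).1
  simp only [hzero, tsum_zero] at hle
  have : ‖f‖ ^ 2 = 0 := le_antisymm (nonpos_of_mul_nonpos_right hle hA) (sq_nonneg _)
  simpa using this

/-- if `B_ε(0) ∩ 𝔍(𝒢)` contains two linearly independent vectors
(where `ε` is a "frame radius" for `g ∈ S₀`), then `𝒢 = L²(ℝ)`. -/
theorem statement_1 (g : L2) (hg : InS0 g) (Λ : Set (ℝ × ℝ)) (hΛ : IsLattice Λ)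
    (ε : ℝ) (hε : 0 < ε)
    (hframe : ∀ Γ : Set (ℝ × ℝ), IsLattice Γ → eballSet ε Γ = Set.univ → IsFrameL2 g Γ)
    (v₁ v₂ : ℝ × ℝ) (hli : LinearIndependent ℝ ![v₁, v₂])
    (hv₁ : v₁ ∈ eball ε 0 ∩ stab (gaborSpan g Λ))
    (hv₂ : v₂ ∈ eball ε 0 ∩ stab (gaborSpan g Λ)) :
    gaborSpan g Λ = Set.univ := by
  rw [gaborSpan_eq_topologicalClosure] at hv₁ hv₂ ⊢
  have hΛS := hΛ.subset_stab_gaborSpan g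
  rw [gaborSpan_eq_topologicalClosure] at hΛS
  set V := (Submodule.span ℂ ((fun z => tf z g) '' Λ)).topologicalClosure
  have hVc : IsClosed (V : Set L2) := Submodule.isClosed_topologicalClosure _
  let S := stabAddSubmonoid V
  have hneg : ∀ {v}, v ∈ S → -v ∈ S := hΛ.neg_mem_of_isClosed S (isClosed_stab hVc) hΛS
  have hd := det_ne_zero_of_linearIndependent hli
  have hgV : g ∈ V := by
    rw [← tf_zero_left g]
    exact Submodule.le_topologicalClosure _ (Submodule.subset_span ⟨0, hΛ.zero_mem, rfl⟩)
  have hsub : gaborSpan g (latticeOf v₁ v₂) ⊆ V := by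
    refine closure_minimal (Submodule.span_le.2 ?_) hVc
    rintro _ ⟨_, ⟨k, l, rfl⟩, rfl⟩
    exact S.add_mem (S.zsmul_mem_of_neg_mem hv₁.2 (hneg hv₁.2) k)
      (S.zsmul_mem_of_neg_mem hv₂.2 (hneg hv₂.2) l) g hgV
  rw [(hframe _ (isLattice_latticeOf hd)
    (eballSet_latticeOf hd hv₁.1 hv₂.1)).gaborSpan_eq_univ] at hsub
  exact Set.univ_subset_iff.1 hsub

end
end

section
/- Let g ∈ L²(ℝ), let Λ ⊆ ℝ² be a lattice, and set 𝒢 = 𝒢(g, Λ). If there exists ε > 0 such that B_ε(Λ) ∩ 𝔍(𝒢) = Λ, then there is some m ∈ ℕ, m ≥ 1, such that 𝔍(𝒢) ⊆ (1/m)Λ. -/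
open MeasureTheory Complex Filter
open scoped ENNReal InnerProductSpace RealInnerProductSpace ComplexConjugate

noncomputable section

/-- Time-frequency shifts compose up to a phase. -/
lemma tf_add (z w : ℝ × ℝ) (f : L2) :
    tf (z + w) f = Complex.exp (-(2 * Real.pi * Complex.I * (z.2 * w.1))) • tf z (tf w f) := by
  have tf_ae : ∀ (u : ℝ × ℝ) (h : L2), tf u h =ᵐ[volume] fun x : ℝ =>
      Complex.exp (2 * Real.pi * Complex.I * (u.2 * ((x - u.1 : ℝ) : ℂ))) * h (x - u.1) := by
    intro u h
    have h2 := (measurePreserving_sub_right volume u.1).quasiMeasurePreserving.ae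
      (memLp_modulate u.2 h).coeFn_toLp
    filter_upwards [(memLp_translate u.1 (Mo u.2 h)).coeFn_toLp, h2] with x hx hx2
    exact hx.trans hx2
  have hw := (measurePreserving_sub_right volume z.1).quasiMeasurePreserving.ae (tf_ae w f)
  refine Lp.ext ?_
  filter_upwards [tf_ae (z + w) f, tf_ae z (tf w f), hw,
    Lp.coeFn_smul (Complex.exp (-(2 * Real.pi * Complex.I * (z.2 * w.1)))) (tf z (tf w f))]
    with x h1 h2 h3 h4
  rw [h1, h4, Pi.smul_apply, h2, h3, smul_eq_mul, ← mul_assoc (Complex.exp _), ← Complex.exp_add,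
    ← mul_assoc (Complex.exp _), ← Complex.exp_add, Prod.fst_add, Prod.snd_add, sub_sub x]
  congr 2
  push_cast
  ring

lemma smul_mem_gaborSpan {g : L2} {Λ : Set (ℝ × ℝ)} (c : ℂ) {f : L2} (hf : f ∈ gaborSpan g Λ) :
    c • f ∈ gaborSpan g Λ :=
  (Submodule.span ℂ ((fun z => tf z g) '' Λ)).topologicalClosure.smul_mem c hf

lemma add_mem_stab {g : L2} {Λ : Set (ℝ × ℝ)} {z w : ℝ × ℝ}
    (hz : z ∈ stab (gaborSpan g Λ)) (hw : w ∈ stab (gaborSpan g Λ)) :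
    z + w ∈ stab (gaborSpan g Λ) := fun f hf => by
  rw [tf_add]
  exact smul_mem_gaborSpan _ (hz _ (hw f hf))

lemma nsmul_mem_stab {g : L2} {Λ : Set (ℝ × ℝ)} {z : ℝ × ℝ}
    (hz : z ∈ stab (gaborSpan g Λ)) {n : ℕ} (hn : 1 ≤ n) :
    n • z ∈ stab (gaborSpan g Λ) := by
  induction n, hn using Nat.le_induction with
  | base => simpa using hz
  | succ k _ ih => rw [succ_nsmul]; exact add_mem_stab ih hz

lemma abs_fract_sub_fract_le {N : ℕ} (hN : 0 < N) {x y : ℝ}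
    (h : ⌊N * Int.fract x⌋₊ = ⌊N * Int.fract y⌋₊) : |Int.fract x - Int.fract y| ≤ (N : ℝ)⁻¹ := by
  have hN' : (0 : ℝ) < N := by exact_mod_cast hN
  have hx := Nat.floor_le (mul_nonneg hN'.le (Int.fract_nonneg x))
  have hx' := Nat.lt_floor_add_one (N * Int.fract x)
  have hy := Nat.floor_le (mul_nonneg hN'.le (Int.fract_nonneg y))
  have hy' := Nat.lt_floor_add_one (N * Int.fract y)
  rw [h] at hx hx'
  have hscaled : |N * (Int.fract x - Int.fract y)| ≤ 1 := by
    rw [abs_le]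
    constructor <;> linarith
  rw [abs_mul, abs_of_pos hN'] at hscaled
  rwa [← mul_le_mul_iff_right₀ hN', mul_inv_cancel₀ hN'.ne']

/-- Simultaneous approximation in the plane: some multiple of `(u, v)`, by a positive factor at
most `N ^ 2`, is within `1 / N` of an integer point. -/
lemma exists_nat_mul_near_int {N : ℕ} (hN : 0 < N) (u v : ℝ) :
    ∃ d : ℕ, 1 ≤ d ∧ d ≤ N * N ∧ ∃ k l : ℤ, |d * u - k| ≤ (N : ℝ)⁻¹ ∧ |d * v - l| ≤ (N : ℝ)⁻¹ := by
  have hlt : ∀ x : ℝ, ⌊N * Int.fract x⌋₊ < N := fun x => by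
    have hN' : (0 : ℝ) < N := by exact_mod_cast hN
    rw [Nat.floor_lt (mul_nonneg hN'.le (Int.fract_nonneg x))]
    nlinarith [Int.fract_lt_one x]
  obtain ⟨i, j, hij, he⟩ := Fintype.exists_ne_map_eq_of_card_lt
    (fun n : Fin (N * N + 1) => ((⟨_, hlt (n * u)⟩, ⟨_, hlt (n * v)⟩) : Fin N × Fin N)) (by simp)
  wlog h : i < j generalizing i j
  · exact this j i hij.symm he.symm (lt_of_le_of_ne (not_lt.mp h) hij.symm)
  simp only [Prod.mk.injEq, Fin.mk.injEq] at he
  have hle : (i : ℕ) ≤ j := h.le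
  refine ⟨j - i, by have : (i : ℕ) < j := h; omega, by omega,
    ⌊(j : ℝ) * u⌋ - ⌊(i : ℝ) * u⌋, ⌊(j : ℝ) * v⌋ - ⌊(i : ℝ) * v⌋, ?_, ?_⟩
  · convert abs_fract_sub_fract_le hN he.1.symm using 2
    simp only [Int.fract]; push_cast [hle]; ring
  · convert abs_fract_sub_fract_le hN he.2.symm using 2
    simp only [Int.fract]; push_cast [hle]; ring

/-- Given a lattice and `ε > 0`, every point of the plane has a multiple, by a uniformly bounded
positive factor, within `ε` of the lattice. -/
lemma IsLattice.exists_nsmul_mem_eballSet {Λ : Set (ℝ × ℝ)} (hΛ : IsLattice Λ) {ε : ℝ}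
    (hε : 0 < ε) : ∃ K : ℕ, ∀ z : ℝ × ℝ, ∃ d : ℕ, 1 ≤ d ∧ d ≤ K ∧ d • z ∈ eballSet ε Λ := by
  obtain ⟨A, hA, rfl⟩ := hΛ
  have hD : A 0 0 * A 1 1 - A 0 1 * A 1 0 ≠ 0 := by
    rw [← Matrix.det_fin_two]; exact hA.ne_zero
  set C := |A 0 0| + |A 0 1| + |A 1 0| + |A 1 1| with hC
  obtain ⟨N, hN⟩ := exists_nat_gt (C / ε)
  have hN0 : (0 : ℝ) < N := lt_of_le_of_lt (by positivity) hN
  refine ⟨N * N, fun z => ?_⟩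
  set u := (A 1 1 * z.1 - A 0 1 * z.2) / (A 0 0 * A 1 1 - A 0 1 * A 1 0) with hu
  set v := (A 0 0 * z.2 - A 1 0 * z.1) / (A 0 0 * A 1 1 - A 0 1 * A 1 0) with hv
  have hz1 : z.1 = A 0 0 * u + A 0 1 * v := by
    rw [hu, hv, ← mul_div_assoc, ← mul_div_assoc, ← add_div, eq_div_iff hD]; ring
  have hz2 : z.2 = A 1 0 * u + A 1 1 * v := by
    rw [hu, hv, ← mul_div_assoc, ← mul_div_assoc, ← add_div, eq_div_iff hD]; ring
  obtain ⟨d, hd1, hd2, k, l, hk, hl⟩ :=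
    exists_nat_mul_near_int (by exact_mod_cast hN0 : 0 < N) u v
  refine ⟨d, hd1, hd2, Set.mem_biUnion (x := (A 0 0 * k + A 0 1 * l, A 1 0 * k + A 1 1 * l))
    ⟨k, l, rfl⟩ ?_⟩
  have bound : ∀ a b : ℝ,
      |d * (a * u + b * v) - (a * k + b * l)| ≤ (|a| + |b|) * (N : ℝ)⁻¹ := fun a b =>
    calc |d * (a * u + b * v) - (a * k + b * l)| = |a * (d * u - k) + b * (d * v - l)| := by
          ring_nf
      _ ≤ |a| * |d * u - k| + |b| * |d * v - l| := by
          rw [← abs_mul, ← abs_mul]; exact abs_add_le _ _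
      _ ≤ |a| * (N : ℝ)⁻¹ + |b| * (N : ℝ)⁻¹ := by gcongr
      _ = _ := by ring
  rw [eball, Set.mem_ofPred_eq, Prod.smul_fst, Prod.smul_snd, nsmul_eq_mul, nsmul_eq_mul, hz1, hz2]
  have b1 := bound (A 0 0) (A 0 1)
  have b2 := bound (A 1 0) (A 1 1)
  set p := d * (A 0 0 * u + A 0 1 * v) - (A 0 0 * k + A 0 1 * l)
  set q := d * (A 1 0 * u + A 1 1 * v) - (A 1 0 * k + A 1 1 * l)
  calc √(p ^ 2 + q ^ 2) ≤ |p| + |q| := by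
        rw [Real.sqrt_le_left (by positivity)]
        nlinarith [sq_abs p, sq_abs q, mul_nonneg (abs_nonneg p) (abs_nonneg q)]
    _ ≤ C * (N : ℝ)⁻¹ := by rw [hC]; linarith
    _ < ε := by rwa [← div_eq_mul_inv, div_lt_comm₀ hN0 hε]

lemma IsLattice.nsmul_mem {Λ : Set (ℝ × ℝ)} (hΛ : IsLattice Λ) (n : ℕ) {z : ℝ × ℝ} (hz : z ∈ Λ) :
    n • z ∈ Λ := by
  obtain ⟨A, -, rfl⟩ := hΛ
  obtain ⟨k, l, rfl⟩ := hz
  refine ⟨n * k, n * l, ?_⟩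
  ext <;> simp <;> ring

/-- if `B_ε(Λ) ∩ 𝔍(𝒢) = Λ`, then `𝔍(𝒢) ⊆ (1/m)Λ` for some `m ≥ 1`. -/
theorem statement_3 (g : L2) (Λ : Set (ℝ × ℝ)) (hΛ : IsLattice Λ)
    (ε : ℝ) (hε : 0 < ε)
    (hiso : eballSet ε Λ ∩ stab (gaborSpan g Λ) = Λ) :
    ∃ m : ℕ, 1 ≤ m ∧
      stab (gaborSpan g Λ) ⊆ {p : ℝ × ℝ | ∃ q ∈ Λ, p = ((m : ℝ))⁻¹ • q} := by
  obtain ⟨K, hK⟩ := hΛ.exists_nsmul_mem_eballSet hε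
  refine ⟨K.factorial, K.factorial_pos, fun z hz => ?_⟩
  obtain ⟨d, hd, hdK, hnear⟩ := hK z
  have hmem : d • z ∈ Λ := hiso ▸ ⟨hnear, nsmul_mem_stab hz hd⟩
  obtain ⟨c, hc⟩ := Nat.dvd_factorial hd hdK
  refine ⟨c • d • z, hΛ.nsmul_mem c hmem, ?_⟩
  have hne : (K.factorial : ℝ) ≠ 0 := by exact_mod_cast K.factorial_ne_zero
  rw [← mul_nsmul, ← hc, ← Nat.cast_smul_eq_nsmul ℝ, inv_smul_smul₀ hne]

end
end
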